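/- Let 0 < α < 1 and λ ≥ 0. Then for every s ∈ ℂ with Re s > 0, the quantity i s^α + λ is nonzero, the function t ↦ e^{−st} K_λ(t) is integrable on (0,∞), and ∫_0^∞ e^{−st} K_λ(t) dt = 1 / (i s^α + λ), where s^α denotes the principal branch. -/

import Mathlib

/-- The Mittag–Leffler function `E_{a,b}(z) = ∑_{k=0}^∞ z^k / Γ(ka + b)`. -/
noncomputable def mittagLeffler (a b : ℝ) (z : ℂ) : ℂ :=
  ∑' k : ℕ, z ^ k / (Real.Gamma (k * a + b) : ℂ)

/-- The kernel `K_λ(t) = -i t^{α-1} E_{α,α}(i λ t^α)`. -/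
noncomputable def fracKernel (α lam t : ℝ) : ℂ :=
  -Complex.I * ((t ^ (α - 1) : ℝ) : ℂ) *
    mittagLeffler α α (Complex.I * (lam : ℂ) * ((t ^ α : ℝ) : ℂ))

open MeasureTheory Set Filter Topology

lemma Real.rpow_mul_exp_neg_le_Gamma {R x : ℝ} (hR : 0 < R) (hx : 1 ≤ x) :
    R ^ (x - 1) * Real.exp (-R) ≤ Real.Gamma x := by
  rw [Real.Gamma_eq_integral (by linarith), ← integral_exp_neg_Ioi, ← integral_const_mul]
  have hc := Real.GammaIntegral_convergent (s := x) (by linarith)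
  refine (setIntegral_mono_on ((integrableOn_exp_neg_Ioi R).const_mul _)
    (hc.mono_set (Ioi_subset_Ioi hR.le)) measurableSet_Ioi fun t ht ↦ ?_).trans
    (setIntegral_mono_set hc ?_ (Ioi_subset_Ioi hR.le).eventuallyLE)
  · rw [mul_comm]
    have := Real.rpow_le_rpow hR.le (le_of_lt ht) (by linarith : 0 ≤ x - 1)
    gcongr
  · filter_upwards [ae_restrict_mem measurableSet_Ioi] with t ht
    have : (0 : ℝ) < t := ht
    positivity

lemma summable_pow_div_Gamma {a b r : ℝ} (ha : 0 < a) (hr : 0 ≤ r) :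
    Summable fun k : ℕ ↦ r ^ k / Real.Gamma (k * a + b) := by
  set R : ℝ := (r + 1) ^ (a⁻¹) with hRdef
  have hR : 0 < R := by positivity
  have hRa : R ^ a = r + 1 := by
    rw [hRdef, ← Real.rpow_mul (by positivity), inv_mul_cancel₀ ha.ne', Real.rpow_one]
  have hgeo : Summable fun k : ℕ ↦ (Real.exp R * R ^ (1 - b)) * (r / (r + 1)) ^ k := by
    refine (summable_geometric_of_lt_one (by positivity) ?_).mul_left _
    rw [div_lt_one (by positivity)]
    linarith
  refine summable_of_isBigO_nat hgeo (Asymptotics.IsBigO.of_bound 1 ?_)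
  have hlim : Tendsto (fun k : ℕ ↦ (k : ℝ) * a + b) atTop atTop :=
    tendsto_atTop_add_const_right _ _ (tendsto_natCast_atTop_atTop.atTop_mul_const ha)
  filter_upwards [hlim.eventually_ge_atTop 1] with k hk
  have hG := Real.rpow_mul_exp_neg_le_Gamma hR hk
  have hpos : 0 < R ^ (k * a + b - 1) * Real.exp (-R) := by positivity
  have hGpos := hpos.trans_le hG
  rw [Real.norm_of_nonneg (by positivity), Real.norm_of_nonneg (by positivity), one_mul]
  calc r ^ k / Real.Gamma (k * a + b) ≤ r ^ k / (R ^ (k * a + b - 1) * Real.exp (-R)) := by gcongr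
    _ = _ := by
      have : R ^ ((k : ℝ) * a + b - 1) = (r + 1) ^ k * (R ^ (1 - b))⁻¹ := by
        rw [← hRa, ← Real.rpow_natCast, ← Real.rpow_mul hR.le, ← Real.rpow_neg hR.le,
          ← Real.rpow_add hR]
        ring_nf
      rw [this, Real.exp_neg, div_pow]
      field_simp

lemma norm_mittagLeffler_term {a b : ℝ} (ha : 0 < a) (hb : 0 < b) (z : ℂ) (k : ℕ) :
    ‖z ^ k / (Real.Gamma (k * a + b) : ℂ)‖ = ‖z‖ ^ k / Real.Gamma (k * a + b) := by
  rw [norm_div, norm_pow, Complex.norm_real,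
    Real.norm_of_nonneg (Real.Gamma_pos_of_pos (by positivity)).le]

lemma summable_mittagLeffler {a b : ℝ} (ha : 0 < a) (hb : 0 < b) (z : ℂ) :
    Summable fun k : ℕ ↦ z ^ k / (Real.Gamma (k * a + b) : ℂ) := by
  refine Summable.of_norm ?_
  simp_rw [norm_mittagLeffler_term ha hb]
  exact summable_pow_div_Gamma ha (norm_nonneg z)

lemma differentiable_mittagLeffler {a b : ℝ} (ha : 0 < a) (hb : 0 < b) :
    Differentiable ℂ (mittagLeffler a b) := by
  intro z
  have : DifferentiableOn ℂ (mittagLeffler a b) (Metric.ball 0 (‖z‖ + 1)) := by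
    refine Complex.differentiableOn_tsum_of_summable_norm
      (summable_pow_div_Gamma (b := b) ha (by positivity : 0 ≤ ‖z‖ + 1))
      (fun k ↦ by fun_prop) Metric.isOpen_ball fun k w hw ↦ ?_
    rw [norm_mittagLeffler_term ha hb]
    have := Real.Gamma_pos_of_pos (by positivity : 0 < (k : ℝ) * a + b)
    have hw' : ‖w‖ ≤ ‖z‖ + 1 := by simpa using (mem_ball_zero_iff.1 hw).le
    gcongr
  exact this.differentiableAt (Metric.isOpen_ball.mem_nhds (by simp))

lemma mittagLeffler_eq_add {a b : ℝ} (ha : 0 < a) (hb : 0 < b) (z : ℂ) :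
    mittagLeffler a b z = 1 / (Real.Gamma b : ℂ) + z * mittagLeffler a (b + a) z := by
  rw [mittagLeffler, (summable_mittagLeffler ha hb z).tsum_eq_zero_add, mittagLeffler,
    ← tsum_mul_left]
  congr 1
  · simp
  · refine tsum_congr fun k ↦ ?_
    rw [show ((k + 1 : ℕ) : ℝ) * a + b = k * a + (b + a) by push_cast; ring, pow_succ']
    ring

/-- The function `t ↦ t^{b-1} E_{a,b}(z t^a)`. -/
noncomputable def mittagLefflerKernel (a b : ℝ) (z : ℂ) (t : ℝ) : ℂ :=
  ((t ^ (b - 1) : ℝ) : ℂ) * mittagLeffler a b (z * ((t ^ a : ℝ) : ℂ))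

lemma mittagLefflerKernel_eq_add {a b : ℝ} (ha : 0 < a) (hb : 0 < b) (z : ℂ) {t : ℝ}
    (ht : 0 < t) : mittagLefflerKernel a b z t =
      ((t ^ (b - 1) : ℝ) : ℂ) * (1 / (Real.Gamma b : ℂ)) +
        z * mittagLefflerKernel a (b + a) z t := by
  rw [mittagLefflerKernel, mittagLeffler_eq_add ha hb, mittagLefflerKernel,
    show b + a - 1 = (b - 1) + a by ring, Real.rpow_add ht]
  push_cast
  ring

lemma continuousOn_mittagLefflerKernel {a b : ℝ} (ha : 0 < a) (hb : 0 < b) (z : ℂ) :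
    ContinuousOn (mittagLefflerKernel a b z) (Ioi 0) := by
  have h (c : ℝ) : ContinuousOn (fun t : ℝ ↦ ((t ^ c : ℝ) : ℂ)) (Ioi 0) := by
    refine Complex.continuous_ofReal.comp_continuousOn fun t ht ↦ ?_
    exact (Real.continuousAt_rpow_const _ _ (.inl (ne_of_gt ht))).continuousWithinAt
  exact (h _).mul ((differentiable_mittagLeffler ha hb).continuous.comp_continuousOn
    (continuousOn_const.mul (h a)))

lemma integrable_tsum_of_summable_integral_norm {X : Type*} [MeasurableSpace X] {μ : Measure X}
    {F : ℕ → X → ℂ} (hm : AEStronglyMeasurable (fun x ↦ ∑' i, F i x) μ)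
    (hF : ∀ i, Integrable (F i) μ) (hs : Summable fun i ↦ ∫ x, ‖F i x‖ ∂μ) :
    Integrable (fun x ↦ ∑' i, F i x) μ := by
  refine ⟨hm, lt_of_le_of_lt (lintegral_mono fun x ↦ enorm_tsum_le_tsum_enorm) ?_⟩
  rw [lintegral_tsum fun i ↦ (hF i).1.enorm]
  simp_rw [← ofReal_integral_norm_eq_lintegral_enorm (hF _)]
  exact hs.tsum_ofReal_lt_top

lemma norm_cexp_neg_mul_ofReal (s : ℂ) (t : ℝ) :
    ‖Complex.exp (-(s * t))‖ = Real.exp (-(s.re * t)) := by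
  simp [Complex.norm_exp]

lemma differentiableOn_laplace {g : ℝ → ℂ}
    (hg : ∀ s : ℂ, 0 < s.re → IntegrableOn (fun t : ℝ ↦ Complex.exp (-(s * t)) * g t) (Ioi 0)) :
    DifferentiableOn ℂ (fun s : ℂ ↦ ∫ t in Ioi (0 : ℝ), Complex.exp (-(s * t)) * g t)
      {s | 0 < s.re} := by
  intro s hs
  have hs : 0 < s.re := hs
  set c := s.re / 3 with hc
  have hcpos : 0 < c := by positivity
  have hgm : AEStronglyMeasurable g (volume.restrict (Ioi 0)) := by
    have h1 := (hg s hs).1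
    have h2 : AEStronglyMeasurable (fun t : ℝ ↦ Complex.exp (s * t)) (volume.restrict (Ioi 0)) :=
      (by fun_prop : Continuous fun t : ℝ ↦ Complex.exp (s * t)).aestronglyMeasurable
    refine (h2.mul h1).congr (.of_forall fun t ↦ ?_)
    simp [← mul_assoc, ← Complex.exp_add]
  have hexp (w : ℂ) : AEStronglyMeasurable (fun t : ℝ ↦ Complex.exp (-(w * t)))
      (volume.restrict (Ioi 0)) :=
    (by fun_prop : Continuous fun t : ℝ ↦ Complex.exp (-(w * t))).aestronglyMeasurable
  refine (hasDerivAt_integral_of_dominated_loc_of_deriv_le (𝕜 := ℂ)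
    (s := {w : ℂ | 2 * c < w.re})
    (F := fun (w : ℂ) (t : ℝ) ↦ Complex.exp (-(w * t)) * g t)
    (F' := fun (w : ℂ) (t : ℝ) ↦ Complex.exp (-(w * t)) * (-t) * g t)
    (bound := fun t : ℝ ↦ c⁻¹ * ‖Complex.exp (-((c : ℂ) * t)) * g t‖)
    ((isOpen_lt continuous_const Complex.continuous_re).mem_nhds
      (by simp only [mem_ofPred_eq]; linarith)) (.of_forall fun w ↦ (hexp w).mul hgm)
    (hg s hs) (((hexp s).mul
      (by fun_prop : Continuous fun t : ℝ ↦ -(t : ℂ)).aestronglyMeasurable).mul hgm) ?_ ?_ ?_).2.differentiableAt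
      |>.differentiableWithinAt
  · filter_upwards [ae_restrict_mem measurableSet_Ioi] with t ht w hw
    have ht : 0 < t := ht
    have hw : 2 * c < w.re := hw
    simp only [norm_mul, norm_cexp_neg_mul_ofReal, norm_neg, Complex.norm_real,
      Real.norm_of_nonneg ht.le, Complex.ofReal_re]
    rw [← mul_assoc]
    refine mul_le_mul_of_nonneg_right ?_ (norm_nonneg _)
    have h1 : c * t ≤ Real.exp (c * t) := by linarith [Real.add_one_le_exp (c * t)]
    have h2 : Real.exp (-(w.re * t)) ≤ Real.exp (-(c * t)) * Real.exp (-(c * t)) := by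
      rw [← Real.exp_add, Real.exp_le_exp]
      nlinarith
    have h3 : t ≤ c⁻¹ * Real.exp (c * t) := by
      rw [le_inv_mul_iff₀ hcpos]; exact h1
    calc _ ≤ Real.exp (-(c * t)) * Real.exp (-(c * t)) * (c⁻¹ * Real.exp (c * t)) := by gcongr
      _ = c⁻¹ * Real.exp (-(c * t)) * (Real.exp (-(c * t)) * Real.exp (c * t)) := by ring
      _ = _ := by rw [← Real.exp_add]; simp
  · exact (hg c (by simpa using hcpos)).norm.const_mul _
  · refine .of_forall fun t w _ ↦ HasDerivAt.mul_const ?_ _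
    have := (((hasDerivAt_id w).mul_const (t : ℂ)).neg).cexp
    simpa using this

lemma integrableOn_cexp_neg_mul_rpow {b : ℝ} (hb : 0 < b) {s : ℂ} (hs : 0 < s.re) :
    IntegrableOn (fun t : ℝ ↦ Complex.exp (-(s * t)) * ((t ^ (b - 1) : ℝ) : ℂ)) (Ioi 0) := by
  have h := integrableOn_rpow_mul_exp_neg_mul_rpow (s := b - 1) (p := 1) (b := s.re)
    (by linarith) one_pos hs
  refine Integrable.mono' h (by fun_prop) ?_
  filter_upwards [ae_restrict_mem measurableSet_Ioi] with t ht
  have ht : 0 < t := ht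
  rw [norm_mul, norm_cexp_neg_mul_ofReal, Complex.norm_real, Real.norm_of_nonneg (by positivity),
    Real.rpow_one, mul_comm, neg_mul]

lemma isOpen_re_pos : IsOpen {s : ℂ | 0 < s.re} := isOpen_lt continuous_const Complex.continuous_re

lemma isPreconnected_re_pos : IsPreconnected {s : ℂ | 0 < s.re} :=
  (convex_halfSpace_re_gt 0).isPreconnected

lemma mem_slitPlane_of_re_pos {s : ℂ} (hs : 0 < s.re) : s ∈ Complex.slitPlane := .inl hs

lemma integral_cexp_neg_mul_rpow {b : ℝ} (hb : 0 < b) {s : ℂ} (hs : 0 < s.re) :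
    ∫ t in Ioi (0 : ℝ), Complex.exp (-(s * t)) * ((t ^ (b - 1) : ℝ) : ℂ) =
      (Real.Gamma b : ℂ) * s ^ (-(b : ℂ)) := by
  have hd := (differentiableOn_laplace (g := fun t ↦ ((t ^ (b - 1) : ℝ) : ℂ))
    fun s hs ↦ integrableOn_cexp_neg_mul_rpow hb hs).analyticOnNhd isOpen_re_pos
  have hd' : DifferentiableOn ℂ (fun s : ℂ ↦ (Real.Gamma b : ℂ) * s ^ (-(b : ℂ)))
      {s | 0 < s.re} := fun s hs ↦
    ((differentiableAt_id.cpow_const (mem_slitPlane_of_re_pos hs)).const_mul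
      _).differentiableWithinAt
  refine hd.eqOn_of_preconnected_of_frequently_eq (hd'.analyticOnNhd isOpen_re_pos)
    isPreconnected_re_pos (z₀ := ((1 : ℝ) : ℂ)) (by simp) ?_ hs
  have ht : Tendsto ((↑) : ℝ → ℂ) (𝓝[≠] 1) (𝓝[≠] ((1 : ℝ) : ℂ)) :=
    Complex.continuous_ofReal.continuousWithinAt.tendsto_nhdsWithin fun x hx ↦ by simpa using hx
  refine ht.frequently (Eventually.frequently ?_)
  filter_upwards [mem_nhdsWithin_of_mem_nhds (lt_mem_nhds one_pos)] with r hr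
  have hr : 0 < r := hr
  have := Real.integral_rpow_mul_exp_neg_mul_Ioi hb hr
  rw [one_div, Real.inv_rpow hr.le, ← Real.rpow_neg hr.le] at this
  rw [← Complex.ofReal_neg, ← Complex.ofReal_cpow hr.le, ← Complex.ofReal_mul, mul_comm, ← this,
    ← integral_complex_ofReal]
  refine integral_congr_ae (.of_forall fun t ↦ ?_)
  push_cast
  ring

lemma cexp_mul_mittagLefflerKernel {a b : ℝ} (s z : ℂ) {t : ℝ} (ht : 0 < t) :
    Complex.exp (-(s * t)) * mittagLefflerKernel a b z t =
      ∑' k : ℕ, z ^ k / (Real.Gamma (k * a + b) : ℂ) *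
        (Complex.exp (-(s * t)) * ((t ^ (k * a + b - 1) : ℝ) : ℂ)) := by
  rw [mittagLefflerKernel, mittagLeffler, ← tsum_mul_left, ← tsum_mul_left]
  refine tsum_congr fun k ↦ ?_
  rw [show (k : ℝ) * a + b - 1 = (b - 1) + a * k by ring, Real.rpow_add ht, Real.rpow_mul ht.le,
    Real.rpow_natCast, mul_pow]
  push_cast
  ring

lemma laplace_mittagLefflerKernel_of_norm_lt {a b : ℝ} (ha : 0 < a) (hb : 0 < b) {s z : ℂ}
    (hs : 0 < s.re) (hz : ‖z‖ < s.re ^ a) :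
    IntegrableOn (fun t : ℝ ↦ Complex.exp (-(s * t)) * mittagLefflerKernel a b z t) (Ioi 0) ∧
    ∫ t in Ioi (0 : ℝ), Complex.exp (-(s * t)) * mittagLefflerKernel a b z t =
      s ^ ((a - b : ℝ) : ℂ) / (s ^ (a : ℂ) - z) := by
  set F : ℕ → ℝ → ℂ := fun k t ↦ z ^ k / (Real.Gamma (k * a + b) : ℂ) *
        (Complex.exp (-(s * t)) * ((t ^ (k * a + b - 1) : ℝ) : ℂ)) with hF
  have hk (k : ℕ) : 0 < (k : ℝ) * a + b := by positivity
  have hs0 : s ≠ 0 := by rintro rfl; simp at hs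
  have hcongr : ∀ᵐ t ∂volume.restrict (Ioi (0 : ℝ)),
      ∑' k, F k t = Complex.exp (-(s * t)) * mittagLefflerKernel a b z t := by
    filter_upwards [ae_restrict_mem measurableSet_Ioi] with t ht
    exact (cexp_mul_mittagLefflerKernel s z ht).symm
  have hint (k : ℕ) : IntegrableOn (F k) (Ioi 0) :=
    (integrableOn_cexp_neg_mul_rpow (hk k) hs).const_mul _
  have hnorm (k : ℕ) : ∫ t in Ioi (0 : ℝ), ‖F k t‖ = s.re ^ (-b) * (‖z‖ / s.re ^ a) ^ k := by
    have hG := Real.Gamma_pos_of_pos (hk k)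
    have h1 : ∫ t in Ioi (0 : ℝ), ‖F k t‖ = ∫ t in Ioi (0 : ℝ),
        ‖z‖ ^ k / Real.Gamma (k * a + b) * (t ^ (k * a + b - 1) * Real.exp (-(s.re * t))) := by
      refine setIntegral_congr_fun measurableSet_Ioi fun t ht ↦ ?_
      have ht : 0 < t := ht
      simp only [hF]
      rw [norm_mul, norm_mittagLeffler_term ha hb, norm_mul, norm_cexp_neg_mul_ofReal,
        Complex.norm_real, Real.norm_of_nonneg (by positivity), mul_comm (Real.exp _)]
    rw [h1, integral_const_mul, Real.integral_rpow_mul_exp_neg_mul_Ioi (hk k) hs, one_div,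
      Real.inv_rpow hs.le, Real.rpow_add hs, mul_comm (k : ℝ), Real.rpow_mul hs.le,
      Real.rpow_natCast, Real.rpow_neg hs.le, div_pow]
    rw [mul_comm (k : ℝ)] at hG
    field_simp
  have hsum : Summable fun k ↦ ∫ t in Ioi (0 : ℝ), ‖F k t‖ := by
    simp_rw [hnorm]
    refine (summable_geometric_of_lt_one (by positivity) ?_).mul_left _
    rwa [div_lt_one (by positivity)]
  have hm : AEStronglyMeasurable (fun t ↦ ∑' k, F k t) (volume.restrict (Ioi 0)) := by
    refine AEStronglyMeasurable.congr ?_ (EventuallyEq.symm hcongr)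
    refine ContinuousOn.aestronglyMeasurable ?_ measurableSet_Ioi
    exact (by fun_prop : Continuous fun t : ℝ ↦ Complex.exp (-(s * t))).continuousOn.mul
      (continuousOn_mittagLefflerKernel ha hb z)
  refine ⟨(integrable_tsum_of_summable_integral_norm hm hint hsum).congr hcongr, ?_⟩
  rw [← integral_congr_ae hcongr, ← integral_tsum_of_summable_integral_norm hint hsum]
  have hterm (k : ℕ) : ∫ t in Ioi (0 : ℝ), F k t =
      s ^ (-(b : ℂ)) * (z / s ^ (a : ℂ)) ^ k := by
    have hG : (Real.Gamma (k * a + b) : ℂ) ≠ 0 := by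
      exact_mod_cast (Real.Gamma_pos_of_pos (hk k)).ne'
    simp only [hF]
    rw [integral_const_mul, integral_cexp_neg_mul_rpow (hk k) hs, div_pow, ← Complex.cpow_mul_nat,
      ← mul_assoc, div_mul_cancel₀ _ hG,
      show (-(((k : ℝ) * a + b : ℝ) : ℂ)) = -(b : ℂ) + -(a * k) by push_cast; ring,
      Complex.cpow_add _ _ hs0, Complex.cpow_neg s (a * k)]
    ring
  have hlt : ‖z / s ^ (a : ℂ)‖ < 1 := by
    rw [norm_div, Complex.norm_cpow_real, div_lt_one (by positivity)]
    exact hz.trans_le (Real.rpow_le_rpow hs.le (Complex.re_le_norm s) ha.le)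
  have hsa : s ^ (a : ℂ) ≠ 0 := by simp [Complex.cpow_eq_zero_iff, hs0]
  have hsub : s ^ (a : ℂ) - z ≠ 0 := by
    intro h
    rw [← sub_eq_zero.1 h, div_self hsa] at hlt
    simp at hlt
  simp_rw [hterm]
  rw [tsum_mul_left, tsum_geometric_of_norm_lt_one hlt, one_sub_div hsa, inv_div,
    Complex.ofReal_sub, sub_eq_add_neg (a : ℂ), Complex.cpow_add _ _ hs0]
  ring

lemma cos_mul_rpow_le_re_cpow {a : ℝ} (ha : 0 < a) (ha1 : a < 1) {s : ℂ} (hs : 0 < s.re) :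
    Real.cos (Real.pi / 2 * a) * ‖s‖ ^ a ≤ (s ^ (a : ℂ)).re := by
  rw [Complex.cpow_ofReal_re, mul_comm]
  have h := Complex.abs_arg_lt_pi_div_two_iff.2 (.inl hs)
  refine mul_le_mul_of_nonneg_left ?_ (by positivity)
  rw [← Real.cos_abs (s.arg * a), abs_mul, abs_of_pos ha]
  have hpi := Real.pi_pos
  refine Real.cos_le_cos_of_nonneg_of_le_pi (by positivity) ?_ (by gcongr)
  nlinarith

lemma cos_pi_div_two_mul_pos {a : ℝ} (ha : 0 < a) (ha1 : a < 1) :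
    0 < Real.cos (Real.pi / 2 * a) := by
  have hpi := Real.pi_pos
  refine Real.cos_pos_of_mem_Ioo ⟨?_, ?_⟩ <;> nlinarith

/-- The Laplace transform of `mittagLefflerKernel` restricted to the line `Re s = ε` is dominated
by an integrable function, uniformly for `z` in a half-plane containing the imaginary axis. -/
lemma exists_laplace_symbol_bound {a b ε : ℝ} (ha : 0 < a) (ha1 : a < 1) (hb : a + 2 ≤ b)
    (hε : 0 < ε) : ∃ m : ℝ, 0 < m ∧ ∃ H : ℝ → ℝ, Integrable H ∧ ∀ ξ : ℝ,
      ‖((ε : ℂ) + 2 * Real.pi * ξ * Complex.I) ^ ((a - b : ℝ) : ℂ)‖ ≤ H ξ ∧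
      ∀ z : ℂ, z.re < m → m ≤ ‖((ε : ℂ) + 2 * Real.pi * ξ * Complex.I) ^ (a : ℂ) - z‖ := by
  have hκ := cos_pi_div_two_mul_pos ha ha1
  set κ := Real.cos (Real.pi / 2 * a) with hκdef
  set c := min ε 1 / 2 with hc
  have hcpos : 0 < c := by positivity
  refine ⟨κ * ε ^ a / 2, by positivity, fun ξ ↦ c ^ (a - b) * (1 + ‖ξ‖) ^ (-(b - a)),
    (integrable_one_add_norm ?_).const_mul _, fun ξ ↦ ?_⟩
  · simp only [Module.finrank_self, Nat.cast_one]
    linarith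
  set S : ℂ := (ε : ℂ) + 2 * Real.pi * ξ * Complex.I with hS
  have hre : S.re = ε := by simp [hS]
  have him : S.im = 2 * Real.pi * ξ := by simp [hS]
  have h1 : ε ≤ ‖S‖ := hre ▸ Complex.re_le_norm S
  have h2 : ‖ξ‖ ≤ ‖S‖ := by
    refine le_trans ?_ (Complex.abs_im_le_norm S)
    rw [him, abs_mul, Real.norm_eq_abs, abs_of_pos Real.two_pi_pos]
    nlinarith [abs_nonneg ξ, Real.pi_gt_three]
  constructor
  · beta_reduce
    have h3 : c * (1 + ‖ξ‖) ≤ ‖S‖ := by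
      nlinarith [norm_nonneg ξ, min_le_left ε 1, min_le_right ε 1]
    rw [Complex.norm_cpow_real, neg_sub, ← Real.mul_rpow hcpos.le (by positivity)]
    exact Real.rpow_le_rpow_of_nonpos (by positivity) h3 (by linarith)
  · intro z hz
    have h4 := cos_mul_rpow_le_re_cpow ha ha1 (hre ▸ hε : 0 < S.re)
    have h5 : κ * ε ^ a ≤ κ * ‖S‖ ^ a := by gcongr
    have h6 := Complex.re_le_norm (S ^ (a : ℂ) - z)
    rw [Complex.sub_re] at h6
    linarith

lemma mittagLefflerKernel_eq_integral_of_norm_lt {a b ε : ℝ} (ha : 0 < a) (hb : 0 < b)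
    (hε : 0 < ε) {z : ℂ} (hz : ‖z‖ < ε ^ a)
    (hint : Integrable fun ξ : ℝ ↦ ((ε : ℂ) + 2 * Real.pi * ξ * Complex.I) ^ ((a - b : ℝ) : ℂ) /
      (((ε : ℂ) + 2 * Real.pi * ξ * Complex.I) ^ (a : ℂ) - z)) {t : ℝ} (ht : 0 < t) :
    Complex.exp (-(ε * t)) * mittagLefflerKernel a b z t =
      ∫ ξ : ℝ, Complex.exp (2 * Real.pi * ξ * t * Complex.I) *
        (((ε : ℂ) + 2 * Real.pi * ξ * Complex.I) ^ ((a - b : ℝ) : ℂ) /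
          (((ε : ℂ) + 2 * Real.pi * ξ * Complex.I) ^ (a : ℂ) - z)) := by
  set g : ℝ → ℂ := fun t ↦ Complex.exp (-(ε * t)) * mittagLefflerKernel a b z t with hg
  set f : ℝ → ℂ := (Ioi 0).indicator g with hf
  have hL (s : ℂ) (hs : s.re = ε) := laplace_mittagLefflerKernel_of_norm_lt (s := s) ha hb
    (hs ▸ hε) (hs ▸ hz)
  have hfi : Integrable f := (integrable_indicator_iff measurableSet_Ioi).2 (hL ε (by simp)).1
  have hF : FourierTransform.fourier f = fun ξ : ℝ ↦
      ((ε : ℂ) + 2 * Real.pi * ξ * Complex.I) ^ ((a - b : ℝ) : ℂ) /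
      (((ε : ℂ) + 2 * Real.pi * ξ * Complex.I) ^ (a : ℂ) - z) := by
    funext ξ
    rw [← (hL _ (by simp)).2, Real.fourier_real_eq_integral_exp_smul,
      ← integral_indicator measurableSet_Ioi]
    refine integral_congr_ae (.of_forall fun u ↦ ?_)
    by_cases hu : u ∈ Ioi (0 : ℝ)
    · simp only [hf, hg, indicator_of_mem hu, smul_eq_mul]
      rw [← mul_assoc, ← Complex.exp_add]
      congr 2
      push_cast
      ring
    · simp [hf, indicator_of_notMem hu]
  have hcont : ContinuousAt f t := by
    have hgt : ContinuousAt g t :=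
      (by fun_prop : Continuous fun t : ℝ ↦ Complex.exp (-(ε * t))).continuousAt.mul
        ((continuousOn_mittagLefflerKernel ha hb z).continuousAt (Ioi_mem_nhds ht))
    refine hgt.congr ?_
    filter_upwards [Ioi_mem_nhds ht] with u hu
    simp [hf, indicator_of_mem hu]
  have hinv := hfi.fourierInv_fourier_eq (hF ▸ hint) hcont
  rw [hF, Real.fourierInv_eq', hf, indicator_of_mem (by exact ht)] at hinv
  refine hinv.symm.trans ?_
  refine integral_congr_ae (.of_forall fun ξ ↦ ?_)
  simp only [smul_eq_mul, RCLike.inner_apply, conj_trivial]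
  congr 2
  push_cast
  ring

lemma exists_norm_mittagLefflerKernel_le {a b ε : ℝ} (ha : 0 < a) (ha1 : a < 1) (hb : a + 2 ≤ b)
    (hε : 0 < ε) : ∃ C : ℝ, ∀ z : ℂ, z.re ≤ 0 → ∀ t : ℝ, 0 < t →
      ‖mittagLefflerKernel a b z t‖ ≤ C * Real.exp (ε * t) := by
  obtain ⟨m, hm, H, hH, hb'⟩ := exists_laplace_symbol_bound ha ha1 hb hε
  have hb0 : 0 < b := by linarith
  set S : ℝ → ℂ := fun ξ ↦ (ε : ℂ) + 2 * Real.pi * ξ * Complex.I with hS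
  have hSm (ξ : ℝ) : S ξ ∈ Complex.slitPlane := .inl (by simpa [hS] using hε)
  have hSc : Continuous S := by fun_prop
  have hScpow (c : ℂ) : Continuous fun ξ ↦ S ξ ^ c := hSc.cpow continuous_const hSm
  have hne {z : ℂ} (hz : z.re < m) (ξ : ℝ) : S ξ ^ (a : ℂ) - z ≠ 0 :=
    norm_pos_iff.1 (hm.trans_le ((hb' ξ).2 z hz))
  have hbd {z : ℂ} (hz : z.re < m) (ξ : ℝ) :
      ‖S ξ ^ ((a - b : ℝ) : ℂ) / (S ξ ^ (a : ℂ) - z)‖ ≤ H ξ / m := by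
    rw [norm_div]
    have h1 := (hb' ξ).1
    have h2 := (hb' ξ).2 z hz
    have h3 := (norm_nonneg _).trans h1
    gcongr
  have hGc {z : ℂ} (hz : z.re < m) :
      Continuous fun ξ ↦ S ξ ^ ((a - b : ℝ) : ℂ) / (S ξ ^ (a : ℂ) - z) :=
    (hScpow _).div ((hScpow _).sub continuous_const) (hne hz)
  have hGi {z : ℂ} (hz : z.re < m) :
      Integrable fun ξ ↦ S ξ ^ ((a - b : ℝ) : ℂ) / (S ξ ^ (a : ℂ) - z) :=
    (hH.div_const m).mono' (hGc hz).aestronglyMeasurable (.of_forall (hbd hz))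
  have hexp (t ξ : ℝ) : ‖Complex.exp (2 * Real.pi * ξ * t * Complex.I)‖ = 1 := by
    rw [← Complex.norm_exp_ofReal_mul_I (2 * Real.pi * ξ * t)]
    push_cast
    rfl
  have hexpc (t : ℝ) : Continuous fun ξ : ℝ ↦ Complex.exp (2 * Real.pi * ξ * t * Complex.I) := by
    fun_prop
  have hopen : IsOpen {z : ℂ | z.re < m} := isOpen_lt Complex.continuous_re continuous_const
  have key (t : ℝ) (ht : 0 < t) : EqOn
      (fun z ↦ Complex.exp (-(ε * t)) * mittagLefflerKernel a b z t)
      (fun z ↦ ∫ ξ : ℝ, Complex.exp (2 * Real.pi * ξ * t * Complex.I) *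
        (S ξ ^ ((a - b : ℝ) : ℂ) / (S ξ ^ (a : ℂ) - z))) {z | z.re < m} := by
    have hd1 : DifferentiableOn ℂ
        (fun z ↦ Complex.exp (-(ε * t)) * mittagLefflerKernel a b z t) {z | z.re < m} := by
      have := differentiable_mittagLeffler ha hb0
      unfold mittagLefflerKernel
      fun_prop
    have hd2 : DifferentiableOn ℂ
        (fun z ↦ ∫ ξ : ℝ, Complex.exp (2 * Real.pi * ξ * t * Complex.I) *
          (S ξ ^ ((a - b : ℝ) : ℂ) / (S ξ ^ (a : ℂ) - z))) {z | z.re < m} := by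
      intro z hz
      refine (hasDerivAt_integral_of_dominated_loc_of_deriv_le (𝕜 := ℂ)
        (s := {z : ℂ | z.re < m})
        (F' := fun (z : ℂ) (ξ : ℝ) ↦ Complex.exp (2 * Real.pi * ξ * t * Complex.I) *
          (S ξ ^ ((a - b : ℝ) : ℂ) / (S ξ ^ (a : ℂ) - z) / (S ξ ^ (a : ℂ) - z)))
        (bound := fun ξ : ℝ ↦ H ξ / m / m) (hopen.mem_nhds hz) ?_ ?_ ?_ ?_
        ((hH.div_const m).div_const m) ?_).2.differentiableAt.differentiableWithinAt
      · filter_upwards [hopen.mem_nhds hz] with w hw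
        exact ((hexpc t).mul (hGc hw)).aestronglyMeasurable
      · exact (hGi hz).bdd_mul (c := 1) (hexpc t).aestronglyMeasurable
          (.of_forall fun ξ ↦ (hexp t ξ).le)
      · exact ((hexpc t).mul ((hGc hz).div ((hScpow _).sub continuous_const)
          (hne hz))).aestronglyMeasurable
      · refine .of_forall fun ξ w hw ↦ ?_
        rw [norm_mul, hexp, one_mul, norm_div]
        have h1 := hbd hw ξ
        have h2 := (hb' ξ).2 w hw
        have h3 := (norm_nonneg _).trans h1
        gcongr
      · refine .of_forall fun ξ w hw ↦ HasDerivAt.const_mul _ ?_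
        have := (hasDerivAt_const w (S ξ ^ ((a - b : ℝ) : ℂ))).fun_div
          ((hasDerivAt_const w (S ξ ^ (a : ℂ))).sub (hasDerivAt_id w)) (hne hw ξ)
        refine this.congr_deriv ?_
        have := hne hw ξ
        simp
        field_simp
    refine (hd1.analyticOnNhd hopen).eqOn_of_preconnected_of_eventuallyEq
      (hd2.analyticOnNhd hopen) (convex_halfSpace_re_lt m).isPreconnected (z₀ := 0)
      (by simpa using hm) ?_
    filter_upwards [hopen.mem_nhds (by simpa using hm : (0 : ℂ) ∈ {z : ℂ | z.re < m}),
      Metric.ball_mem_nhds (0 : ℂ) (by positivity : 0 < ε ^ a)] with z hz hz'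
    exact mittagLefflerKernel_eq_integral_of_norm_lt ha hb0 hε (by simpa using hz') (hGi hz) ht
  refine ⟨∫ ξ, H ξ / m, fun z hz t ht ↦ ?_⟩
  have hzm : z.re < m := hz.trans_lt hm
  have h1 : ‖Complex.exp (-(ε * t)) * mittagLefflerKernel a b z t‖ ≤ ∫ ξ, H ξ / m := by
    refine (congrArg norm (key t ht hzm)).trans_le ?_
    refine norm_integral_le_of_norm_le (hH.div_const m) (.of_forall fun ξ ↦ ?_)
    rw [norm_mul, hexp, one_mul]
    exact hbd hzm ξ
  rw [norm_mul, norm_cexp_neg_mul_ofReal, Complex.ofReal_re, Real.exp_neg,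
    inv_mul_le_iff₀ (Real.exp_pos _)] at h1
  linarith

lemma integrableOn_cexp_mul_mittagLefflerKernel_add_nat_mul {a b : ℝ} (ha : 0 < a) (hb : 0 < b)
    {s z : ℂ} (hs : 0 < s.re) (n : ℕ)
    (h : IntegrableOn (fun t : ℝ ↦ Complex.exp (-(s * t)) * mittagLefflerKernel a (b + n * a) z t)
      (Ioi 0)) :
    IntegrableOn (fun t : ℝ ↦ Complex.exp (-(s * t)) * mittagLefflerKernel a b z t) (Ioi 0) := by
  induction n with
  | zero => simpa using h
  | succ n ih =>
    refine ih ?_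
    have hb' : 0 < b + n * a := by positivity
    rw [show b + ((n + 1 : ℕ) : ℝ) * a = b + n * a + a by push_cast; ring] at h
    refine (((integrableOn_cexp_neg_mul_rpow hb' hs).mul_const
      (1 / (Real.Gamma (b + n * a) : ℂ))).add (h.const_mul z)).congr ?_
    filter_upwards [ae_restrict_mem measurableSet_Ioi] with t ht
    rw [mittagLefflerKernel_eq_add ha hb' z ht, Pi.add_apply]
    ring

lemma integrableOn_cexp_mul_mittagLefflerKernel {a b : ℝ} (ha : 0 < a) (ha1 : a < 1) (hb : 0 < b)
    {s z : ℂ} (hs : 0 < s.re) (hz : z.re ≤ 0) :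
    IntegrableOn (fun t : ℝ ↦ Complex.exp (-(s * t)) * mittagLefflerKernel a b z t) (Ioi 0) := by
  obtain ⟨n, hn⟩ := exists_nat_ge ((a + 2) / a)
  refine integrableOn_cexp_mul_mittagLefflerKernel_add_nat_mul ha hb hs n ?_
  have hbn : 0 < b + n * a := by positivity
  obtain ⟨C, hC⟩ := exists_norm_mittagLefflerKernel_le (b := b + n * a) ha ha1
    (by rw [div_le_iff₀ ha] at hn; linarith) (half_pos hs)
  refine Integrable.mono'
    ((integrableOn_exp_mul_Ioi (a := -(s.re / 2)) (by linarith) 0).const_mul C)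
    (ContinuousOn.aestronglyMeasurable ?_ measurableSet_Ioi) ?_
  · exact (by fun_prop : Continuous fun t : ℝ ↦ Complex.exp (-(s * t))).continuousOn.mul
      (continuousOn_mittagLefflerKernel ha hbn z)
  · filter_upwards [ae_restrict_mem measurableSet_Ioi] with t ht
    rw [norm_mul, norm_cexp_neg_mul_ofReal]
    calc _ ≤ Real.exp (-(s.re * t)) * (C * Real.exp (s.re / 2 * t)) := by
          gcongr
          exact hC z hz t ht
      _ = C * (Real.exp (-(s.re * t)) * Real.exp (s.re / 2 * t)) := by ring
      _ = _ := by
        rw [← Real.exp_add]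
        ring_nf

lemma cpow_sub_ne_zero_of_re_nonpos {a : ℝ} (ha : 0 < a) (ha1 : a < 1) {s z : ℂ} (hs : 0 < s.re)
    (hz : z.re ≤ 0) : s ^ (a : ℂ) - z ≠ 0 := by
  intro h
  have h1 := cos_mul_rpow_le_re_cpow ha ha1 hs
  have h2 : 0 < ‖s‖ := hs.trans_le (Complex.re_le_norm s)
  have h3 := mul_pos (cos_pi_div_two_mul_pos ha ha1) (Real.rpow_pos_of_pos h2 a)
  rw [sub_eq_zero.1 h] at h1
  linarith

lemma laplace_mittagLefflerKernel {a b : ℝ} (ha : 0 < a) (ha1 : a < 1) (hb : 0 < b)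
    {s z : ℂ} (hs : 0 < s.re) (hz : z.re ≤ 0) :
    ∫ t in Ioi (0 : ℝ), Complex.exp (-(s * t)) * mittagLefflerKernel a b z t =
      s ^ ((a - b : ℝ) : ℂ) / (s ^ (a : ℂ) - z) := by
  have hd1 := differentiableOn_laplace (g := mittagLefflerKernel a b z)
    fun s hs ↦ integrableOn_cexp_mul_mittagLefflerKernel ha ha1 hb hs hz
  have hd2 : DifferentiableOn ℂ (fun s : ℂ ↦ s ^ ((a - b : ℝ) : ℂ) / (s ^ (a : ℂ) - z))
      {s | 0 < s.re} := fun s hs ↦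
    ((differentiableAt_id.cpow_const (mem_slitPlane_of_re_pos hs)).div
      ((differentiableAt_id.cpow_const (mem_slitPlane_of_re_pos hs)).sub_const z)
      (cpow_sub_ne_zero_of_re_nonpos ha ha1 hs hz)).differentiableWithinAt
  set σ : ℝ := (‖z‖ + 1) ^ a⁻¹ with hσ
  have hσpos : 0 < σ := by positivity
  refine (hd1.analyticOnNhd isOpen_re_pos).eqOn_of_preconnected_of_eventuallyEq
    (hd2.analyticOnNhd isOpen_re_pos) isPreconnected_re_pos (z₀ := ((σ + 1 : ℝ) : ℂ))
    (by simp only [mem_ofPred_eq, Complex.ofReal_re]; positivity) ?_ hs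
  filter_upwards [(isOpen_lt continuous_const Complex.continuous_re).mem_nhds
    (by simp : ((σ + 1 : ℝ) : ℂ) ∈ {w : ℂ | σ < w.re})] with w hw
  have hw : σ < w.re := hw
  refine (laplace_mittagLefflerKernel_of_norm_lt ha hb (hσpos.trans hw) ?_).2
  calc ‖z‖ < ‖z‖ + 1 := by linarith
    _ = σ ^ a := by
      rw [hσ, ← Real.rpow_mul (by positivity), inv_mul_cancel₀ ha.ne', Real.rpow_one]
    _ ≤ w.re ^ a := Real.rpow_le_rpow hσpos.le hw.le ha.le

/-- For `0 < α < 1`, `λ ≥ 0` and `Re s > 0`: `i s^α + λ ≠ 0`, the function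
`t ↦ e^{-st} K_λ(t)` is integrable on `(0,∞)`, and
`∫_0^∞ e^{-st} K_λ(t) dt = 1/(i s^α + λ)`, with `s^α` the principal branch. -/
theorem laplace_fracKernel (α lam : ℝ) (h0 : 0 < α) (h1 : α < 1) (hlam : 0 ≤ lam) :
    ∀ s : ℂ, 0 < s.re →
      (Complex.I * s ^ (α : ℂ) + (lam : ℂ) ≠ 0) ∧
      MeasureTheory.IntegrableOn
        (fun t : ℝ => Complex.exp (-(s * (t : ℂ))) * fracKernel α lam t) (Set.Ioi 0) ∧
      ∫ t in Set.Ioi (0:ℝ), Complex.exp (-(s * (t : ℂ))) * fracKernel α lam t =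
        1 / (Complex.I * s ^ (α : ℂ) + (lam : ℂ)) := by
  intro s hs
  set z : ℂ := Complex.I * lam with hz
  have hzre : z.re ≤ 0 := by simp [hz]
  have hfactor : Complex.I * s ^ (α : ℂ) + lam = Complex.I * (s ^ (α : ℂ) - z) := by
    linear_combination (lam : ℂ) * Complex.I_mul_I
  have hker : (fun t : ℝ ↦ Complex.exp (-(s * (t : ℂ))) * fracKernel α lam t) =
      fun t : ℝ ↦ -Complex.I * (Complex.exp (-(s * t)) * mittagLefflerKernel α α z t) := by
    funext t
    rw [fracKernel, mittagLefflerKernel]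
    ring
  rw [hker, hfactor, integral_const_mul, laplace_mittagLefflerKernel h0 h1 h0 hs hzre]
  refine ⟨mul_ne_zero Complex.I_ne_zero (cpow_sub_ne_zero_of_re_nonpos h0 h1 hs hzre),
    (integrableOn_cexp_mul_mittagLefflerKernel h0 h1 h0 hs hzre).const_mul _, ?_⟩
  simp [div_eq_mul_inv, mul_comm]
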